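/- arXiv:1301.2615 — 2 statements merged into one kernel-verified Lean document; each statement's English description precedes it below -/
import Mathlib

section
/- Let θ = (√2 + √6)/2, a real algebraic number with minimal polynomial X⁴ − 4X² + 1 over ℚ, and let B = ℤ[θ]. Let a, b, c ∈ B and A = B[X,Y]/(aX² + bXY + cY² − 1). Then A is a smooth B-algebra if and only if b is not divisible by 1 + θ, or a, b, c are all divisible by 1 + θ. -/
set_option synthInstance.maxHeartbeats 800000
set_option maxHeartbeats 1600000

open MvPolynomial

/-- `θ = (√2 + √6)/2` as a real number. -/
noncomputable def theta : ℝ := (Real.sqrt 2 + Real.sqrt 6) / 2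

/-- `B = ℤ[θ]`, realized as a subalgebra of `ℝ`. -/
noncomputable def B : Subalgebra ℤ ℝ := Algebra.adjoin ℤ {theta}

/-- `θ` as an element of `B`. -/
noncomputable def θB : B := ⟨theta, Algebra.subset_adjoin rfl⟩

/-- The polynomial `a X² + b XY + c Y² - 1` in `B[X,Y]`. -/
noncomputable abbrev quadPoly (a b c : B) : MvPolynomial (Fin 2) B :=
  C a * X 0 ^ 2 + C b * X 0 * X 1 + C c * X 1 ^ 2 - 1

/-- The ring `A = B[X,Y]/(a X² + b XY + c Y² - 1)`. -/
noncomputable abbrev QuadAlg (a b c : B) :=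
  MvPolynomial (Fin 2) B ⧸ Ideal.span {quadPoly a b c}

/-- The coordinate ring `S[X,Y]/(a X² + b XY + c Y² - 1)` over a commutative ring `S`. -/
noncomputable abbrev ConicAlgebra {S : Type*} [CommRing S] (a b c : S) :=
  MvPolynomial (Fin 2) S ⧸
    Ideal.span {C a * X 0 ^ 2 + C b * X 0 * X 1 + C c * X 1 ^ 2 - (1 : MvPolynomial (Fin 2) S)}

namespace ConicAlgebra

variable {S : Type*} [CommRing S] {a b c : S} {R : Type*} [CommRing R] [Algebra S R]

/-- The class of the `i`-th variable. -/
noncomputable def coord (a b c : S) (i : Fin 2) : ConicAlgebra a b c := Ideal.Quotient.mk _ (X i)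

theorem equation (a b c : S) :
    algebraMap S (ConicAlgebra a b c) a * coord a b c 0 ^ 2
      + algebraMap S (ConicAlgebra a b c) b * coord a b c 0 * coord a b c 1
      + algebraMap S (ConicAlgebra a b c) c * coord a b c 1 ^ 2 = 1 := by
  have h := Ideal.Quotient.eq_zero_iff_mem.mpr (Ideal.mem_span_singleton_self
    (C a * X 0 ^ 2 + C b * X 0 * X 1 + C c * X 1 ^ 2 - (1 : MvPolynomial (Fin 2) S)))
  rw [map_sub, sub_eq_zero] at h
  simp only [map_add, map_mul, map_pow, map_one] at h
  exact h

theorem algHom_equation (g : ConicAlgebra a b c →ₐ[S] R) :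
    algebraMap S R a * g (coord a b c 0) ^ 2
      + algebraMap S R b * g (coord a b c 0) * g (coord a b c 1)
      + algebraMap S R c * g (coord a b c 1) ^ 2 = 1 := by
  simpa only [map_add, map_mul, map_pow, map_one, AlgHom.commutes] using
    congrArg g (equation a b c)

theorem exists_algHom {x y : R}
    (h : algebraMap S R a * x ^ 2 + algebraMap S R b * x * y + algebraMap S R c * y ^ 2 = 1) :
    ∃ g : ConicAlgebra a b c →ₐ[S] R, g (coord a b c 0) = x ∧ g (coord a b c 1) = y := by
  refine ⟨Ideal.Quotient.liftₐ _ (aeval ![x, y]) fun p hp ↦ ?_, ?_, ?_⟩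
  · obtain ⟨q, rfl⟩ := Ideal.mem_span_singleton.mp hp
    rw [map_mul]
    convert! zero_mul _
    simp [h]
  · exact (aeval_X ![x, y] 0).trans rfl
  · exact (aeval_X ![x, y] 1).trans rfl

theorem algHom_ext {g g' : ConicAlgebra a b c →ₐ[S] R}
    (h₀ : g (coord a b c 0) = g' (coord a b c 0)) (h₁ : g (coord a b c 1) = g' (coord a b c 1)) :
    g = g' := by
  refine Ideal.Quotient.algHom_ext _ (MvPolynomial.algHom_ext fun i ↦ ?_)
  fin_cases i
  · exact h₀
  · exact h₁

/-- If `2` and `b` generate the unit ideal, so do the partial derivatives of the conic. -/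
theorem exists_gradient_combination {T : Type*} [CommRing T] {a b c x y : T}
    (h : a * x ^ 2 + b * x * y + c * y ^ 2 = 1) (hb : IsCoprime 2 b) :
    ∃ p q, p * (2 * a * x + b * y) + q * (b * x + 2 * c * y) = 1 := by
  obtain ⟨u, v, huv⟩ := hb
  refine ⟨(u - v * (2 * a * c * x * y + a * b * x ^ 2)) * x + v * (b * x + c * y),
    (u - v * (2 * a * c * x * y + a * b * x ^ 2)) * y + v * a * x, ?_⟩
  linear_combination (2 * (u - v * (2 * a * c * x * y + a * b * x ^ 2)) + v * b) * h + huv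

/-- A conic is smooth as soon as `2` and `b` generate the unit ideal of its coordinate ring. -/
theorem smooth_of_isCoprime (h : IsCoprime 2 (algebraMap S (ConicAlgebra a b c) b)) :
    Algebra.Smooth S (ConicAlgebra a b c) where
  finitePresentation := .quotient ⟨{_}, by rw [Finset.coe_singleton]⟩
  formallySmooth := by
    refine .of_comp_surjective fun R _ _ I hI g ↦ ?_
    obtain ⟨p, q, hpq⟩ := exists_gradient_combination (algHom_equation g)
      (by
        have h := h.map (g : ConicAlgebra a b c →+* R ⧸ I)
        rwa [map_ofNat, RingHom.coe_coe, AlgHom.commutes] at h)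
    obtain ⟨x, hx⟩ := Ideal.Quotient.mk_surjective (g (coord a b c 0))
    obtain ⟨y, hy⟩ := Ideal.Quotient.mk_surjective (g (coord a b c 1))
    obtain ⟨p, rfl⟩ := Ideal.Quotient.mk_surjective p
    obtain ⟨q, rfl⟩ := Ideal.Quotient.mk_surjective q
    have hg := algHom_equation g
    simp only [← hx, ← hy, ← Ideal.Quotient.mk_algebraMap] at hpq hg
    set α := algebraMap S R a
    set β := algebraMap S R b
    set γ := algebraMap S R c
    have hε : α * x ^ 2 + β * x * y + γ * y ^ 2 - 1 ∈ I := by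
      rw [← Ideal.Quotient.eq_zero_iff_mem]
      simp only [map_add, map_mul, map_pow, map_one, map_sub, hg, sub_self]
    have hδ : p * (2 * α * x + β * y) + q * (β * x + 2 * γ * y) - 1 ∈ I := by
      rw [← Ideal.Quotient.eq_zero_iff_mem]
      simp only [map_add, map_mul, map_one, map_sub, map_ofNat, hpq, sub_self]
    have hmul {s t : R} (hs : s ∈ I) (ht : t ∈ I) : s * t = 0 := by
      rw [← Ideal.mem_bot, ← hI, pow_two]
      exact Ideal.mul_mem_mul hs ht
    set ε := α * x ^ 2 + β * x * y + γ * y ^ 2 - 1 with hεdef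
    obtain ⟨f, hf₀, hf₁⟩ := exists_algHom (a := a) (b := b) (c := c)
      (x := x - p * ε) (y := y - q * ε) (by
        linear_combination -hmul hε hδ + (α * p ^ 2 + β * p * q + γ * q ^ 2) * hmul hε hε - hεdef)
    refine ⟨f, algHom_ext ?_ ?_⟩
    · simp [hf₀, ← hx, Ideal.Quotient.eq_zero_iff_mem.mpr hε]
    · simp [hf₁, ← hy, Ideal.Quotient.eq_zero_iff_mem.mpr hε]

/-- A conic is not formally smooth if some nonzero fibre of characteristic `2` is given by an
equation `a X² + c Y² = 1` with a solution: the tangent vector `(u, v)` at the point `(u, v)` does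
not extend to second order. -/
theorem not_formallySmooth_of_fibre {k : Type*} [CommRing k] [Nontrivial k] [Algebra S k]
    (h2 : (2 : k) = 0) (hb : algebraMap S k b = 0) {u v : k}
    (huv : algebraMap S k a * u ^ 2 + algebraMap S k c * v ^ 2 = 1) :
    ¬ Algebra.FormallySmooth S (ConicAlgebra a b c) := by
  intro _
  let J : Ideal (Polynomial k) := Ideal.span {Polynomial.X ^ 3}
  let R := Polynomial k ⧸ J
  let ι : k →+* R := (Ideal.Quotient.mk J).comp Polynomial.C
  have hι (s : S) : algebraMap S R s = ι (algebraMap S k s) := rfl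
  let e : R := Ideal.Quotient.mk J Polynomial.X
  have he : e ^ 3 = 0 :=
    Ideal.Quotient.eq_zero_iff_mem.mpr (Ideal.mem_span_singleton_self (Polynomial.X ^ 3))
  have he2 : e ^ 2 ≠ 0 := by
    intro h
    have h := Ideal.mem_span_singleton.mp (Ideal.Quotient.eq_zero_iff_mem.mp
      (show Ideal.Quotient.mk J (Polynomial.X ^ 2) = 0 from h))
    simpa using Polynomial.X_pow_dvd_iff.mp h 2 (by norm_num)
  have h2 : (2 : R) = 0 := by rw [← map_ofNat ι 2, h2, map_zero]
  have hb : algebraMap S R b = 0 := by rw [hι, hb, map_zero]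
  have huv : algebraMap S R a * ι u ^ 2 + algebraMap S R c * ι v ^ 2 = 1 := by
    simpa [hι] using congrArg ι huv
  let I : Ideal R := Ideal.span {e ^ 2}
  have heI : Ideal.Quotient.mk I e ^ 2 = 0 :=
    Ideal.Quotient.eq_zero_iff_mem.mpr (Ideal.mem_span_singleton_self (e ^ 2))
  have hI : I ^ 2 = ⊥ := by
    rw [Ideal.span_singleton_pow, Ideal.span_singleton_eq_bot]
    linear_combination e * he
  have ha (s : S) : algebraMap S (R ⧸ I) s = Ideal.Quotient.mk I (algebraMap S R s) :=
    (Ideal.Quotient.mk_algebraMap S I s).symm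
  obtain ⟨g, hg₀, hg₁⟩ := exists_algHom (a := a) (b := b) (c := c)
      (x := Ideal.Quotient.mk I (ι u * (1 + e))) (y := Ideal.Quotient.mk I (ι v * (1 + e))) (by
    have h2' : (2 : R ⧸ I) = 0 := by
      rw [← map_ofNat (Ideal.Quotient.mk I) 2, h2, map_zero]
    have huv' := congrArg (Ideal.Quotient.mk I) huv
    simp only [ha, hb, map_add, map_mul, map_pow, map_one, map_zero] at huv' ⊢
    linear_combination (1 + Ideal.Quotient.mk I e) ^ 2 * huv' + Ideal.Quotient.mk I e * h2' + heI)
  obtain ⟨f, rfl⟩ := Algebra.FormallySmooth.comp_surjective S _ I hI g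
  obtain ⟨s, hs⟩ := Ideal.mem_span_singleton.mp (Ideal.Quotient.eq.mp hg₀)
  obtain ⟨t, ht⟩ := Ideal.mem_span_singleton.mp (Ideal.Quotient.eq.mp hg₁)
  have hf := algHom_equation f
  change f (coord a b c 0) - _ = _ at hs
  change f (coord a b c 1) - _ = _ at ht
  rw [eq_add_of_sub_eq hs, eq_add_of_sub_eq ht, hb] at hf
  refine he2 ?_
  set α := algebraMap S R a
  set γ := algebraMap S R c
  linear_combination hf - (1 + e) ^ 2 * huv
    - (e + α * ι u * (1 + e) * e ^ 2 * s + γ * ι v * (1 + e) * e ^ 2 * t) * h2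
    - (α * s ^ 2 + γ * t ^ 2) * e * he

end ConicAlgebra

theorem theta_relation : theta ^ 4 - 4 * theta ^ 2 + 1 = 0 := by
  have h2 : √2 ^ 2 = (2 : ℝ) := Real.sq_sqrt (by norm_num)
  have h6 : √6 ^ 2 = (6 : ℝ) := Real.sq_sqrt (by norm_num)
  have hsq : theta ^ 2 = 2 + √2 * √6 / 2 := by
    rw [theta]
    linear_combination (h2 + h6) / 4
  linear_combination (theta ^ 2 - 2 + √2 * √6 / 2) * hsq + √6 ^ 2 / 4 * h2 + h6 / 2

theorem θB_relation : θB ^ 4 - 4 * θB ^ 2 + 1 = 0 := Subtype.ext theta_relation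

theorem one_add_θB_dvd_two : 1 + θB ∣ 2 :=
  ⟨θB ^ 3 - θB ^ 2 - 3 * θB + 3, by linear_combination -θB_relation⟩

theorem two_dvd_one_add_θB_pow_four : 2 ∣ (1 + θB) ^ 4 :=
  ⟨2 * θB ^ 3 + 5 * θB ^ 2 + 2 * θB, by linear_combination θB_relation⟩

theorem isIntegral_of_mem_B {x : ℝ} (hx : x ∈ B) : IsIntegral ℤ x := by
  have hθ : IsIntegral ℤ theta := by
    refine ⟨Polynomial.X ^ 4 - 4 * Polynomial.X ^ 2 + 1, by monicity!, ?_⟩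
    simpa using theta_relation
  exact adjoin_le_integralClosure hθ hx

theorem not_isUnit_two_B : ¬ IsUnit (2 : B) := by
  intro h
  obtain ⟨x, hx⟩ := h.exists_right_inv
  have hx : 2 * (x : ℝ) = 1 := congrArg Subtype.val hx
  have hx : (x : ℝ) = algebraMap ℚ ℝ (1 / 2) := by
    rw [map_div₀, map_one, map_ofNat]
    linarith
  have hint := isIntegral_of_mem_B x.2
  rw [hx, isIntegral_algebraMap_iff (algebraMap ℚ ℝ).injective,
    IsIntegrallyClosed.isIntegral_iff] at hint
  obtain ⟨n, hn⟩ := hint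
  have hn : (2 * n : ℚ) = 1 := by
    rw [show (n : ℚ) = 1 / 2 from hn]
    norm_num
  have : 2 * n = 1 := by exact_mod_cast hn
  omega

theorem not_isUnit_one_add_θB : ¬ IsUnit (1 + θB) := fun h ↦
  not_isUnit_two_B (isUnit_of_dvd_unit two_dvd_one_add_θB_pow_four (h.pow 4))

/-- The residue ring `B/(1 + θ)` has only the elements `0` and `1`. -/
theorem one_add_θB_dvd_or_dvd_sub_one (x : B) : 1 + θB ∣ x ∨ 1 + θB ∣ x - 1 := by
  suffices h : ∃ n : ℤ, 1 + θB ∣ x - n by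
    obtain ⟨n, hn⟩ := h
    obtain ⟨m, rfl | rfl⟩ := n.even_or_odd'
    · refine .inl ((dvd_iff_dvd_of_dvd_sub hn).mpr ?_)
      push_cast
      exact one_add_θB_dvd_two.mul_right _
    · refine .inr ((dvd_iff_dvd_of_dvd_sub (b := x - 1) (c := 2 * m) ?_).mpr
        (one_add_θB_dvd_two.mul_right _))
      convert! hn using 1
      push_cast
      ring
  obtain ⟨x, hx⟩ := x
  induction hx using Algebra.adjoin_induction with
  | mem x hx =>
    obtain rfl := Set.mem_singleton_iff.mp hx
    refine ⟨-1, 1, ?_⟩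
    change θB - _ = _
    push_cast
    ring
  | algebraMap n =>
    refine ⟨n, 0, ?_⟩
    rw [mul_zero, sub_eq_zero]
    rfl
  | add x y hx hy ihx ihy =>
    obtain ⟨m, s, hs⟩ := ihx
    obtain ⟨n, t, ht⟩ := ihy
    refine ⟨m + n, s + t, ?_⟩
    change (⟨x, hx⟩ + ⟨y, hy⟩ : B) - _ = _
    push_cast
    linear_combination hs + ht
  | mul x y hx hy ihx ihy =>
    obtain ⟨m, s, hs⟩ := ihx
    obtain ⟨n, t, ht⟩ := ihy
    refine ⟨m * n, s * ⟨y, hy⟩ + m * t, ?_⟩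
    change (⟨x, hx⟩ * ⟨y, hy⟩ : B) - _ = _
    push_cast
    linear_combination (⟨y, hy⟩ : B) * hs + (m : B) * ht

theorem isCoprime_one_add_θB {b : B} (hb : ¬ 1 + θB ∣ b) : IsCoprime (1 + θB) b := by
  obtain ⟨k, hk⟩ := (one_add_θB_dvd_or_dvd_sub_one b).resolve_left hb
  exact ⟨-k, 1, by linear_combination hk⟩

theorem smooth_iff_sqrt2_sqrt6 (a b c : B) :
    Algebra.Smooth B (QuadAlg a b c) ↔
      ¬ (1 + θB) ∣ b ∨ ((1 + θB) ∣ a ∧ (1 + θB) ∣ b ∧ (1 + θB) ∣ c) := by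
  constructor
  · intro h
    by_contra! hcon
    obtain ⟨hb, hac⟩ := hcon
    let k := B ⧸ Ideal.span {1 + θB}
    have : Nontrivial k := Ideal.Quotient.nontrivial_iff.mpr
      (mt Ideal.span_singleton_eq_top.mp not_isUnit_one_add_θB)
    have hzero {x : B} (hx : 1 + θB ∣ x) : algebraMap B k x = 0 :=
      Ideal.Quotient.eq_zero_iff_mem.mpr (Ideal.mem_span_singleton.mpr hx)
    have hone {x : B} (hx : ¬ 1 + θB ∣ x) : algebraMap B k x = 1 := by
      rw [← sub_eq_zero, ← map_one (algebraMap B k), ← map_sub]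
      exact hzero ((one_add_θB_dvd_or_dvd_sub_one x).resolve_left hx)
    have h2 : (2 : k) = 0 := (map_ofNat (algebraMap B k) 2).symm.trans (hzero one_add_θB_dvd_two)
    by_cases ha : 1 + θB ∣ a
    · exact ConicAlgebra.not_formallySmooth_of_fibre h2 (hzero hb) (u := 0) (v := 1)
        (by simp [hone (hac ha hb)]) h.formallySmooth
    · exact ConicAlgebra.not_formallySmooth_of_fibre h2 (hzero hb) (u := 1) (v := 0)
        (by simp [hone ha]) h.formallySmooth
  · intro h
    have hcop : IsCoprime (algebraMap B (QuadAlg a b c) (1 + θB))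
        (algebraMap B (QuadAlg a b c) b) := by
      obtain hb | ⟨⟨a', ha⟩, ⟨b', hb⟩, ⟨c', hc⟩⟩ := h
      · exact (isCoprime_one_add_θB hb).map _
      · refine ⟨algebraMap B _ a' * ConicAlgebra.coord a b c 0 ^ 2
          + algebraMap B _ b' * ConicAlgebra.coord a b c 0 * ConicAlgebra.coord a b c 1
          + algebraMap B _ c' * ConicAlgebra.coord a b c 1 ^ 2, 0, ?_⟩
        have h := ConicAlgebra.equation a b c
        have ha := congrArg (algebraMap B (QuadAlg a b c)) ha
        have hb := congrArg (algebraMap B (QuadAlg a b c)) hb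
        have hc := congrArg (algebraMap B (QuadAlg a b c)) hc
        rw [map_mul] at ha hb hc
        linear_combination h - ConicAlgebra.coord a b c 0 ^ 2 * ha
          - ConicAlgebra.coord a b c 0 * ConicAlgebra.coord a b c 1 * hb
          - ConicAlgebra.coord a b c 1 ^ 2 * hc
    refine ConicAlgebra.smooth_of_isCoprime ((hcop.pow_left (m := 4)).of_isCoprime_of_dvd_left ?_)
    rw [← map_pow, ← map_ofNat (algebraMap B (QuadAlg a b c)) 2]
    exact map_dvd _ two_dvd_one_add_θB_pow_four
end

section
/- Let θ = (√2 + √6)/2, a real algebraic number with minimal polynomial X⁴ − 4X² + 1 over ℚ, and let B = ℤ[θ]. Then B is a principal ideal domain and 2B = (1 + θ)⁴B, i.e. 2 and (1 + θ)⁴ generate the same ideal of B. -/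
open Polynomial NumberField IntermediateField

theorem theta_sq : theta ^ 2 = 2 + Real.sqrt 3 := by
  have h2 : Real.sqrt 2 ^ 2 = 2 := Real.sq_sqrt (by norm_num)
  have h3 : Real.sqrt 3 ^ 2 = 3 := Real.sq_sqrt (by norm_num)
  have h6 : Real.sqrt 6 = Real.sqrt 2 * Real.sqrt 3 := by
    rw [← Real.sqrt_mul (by norm_num)]; norm_num
  rw [theta, h6]
  linear_combination (1 + 2 * Real.sqrt 3 + Real.sqrt 3 ^ 2) / 4 * h2 + 1 / 2 * h3

theorem theta_pow_four : theta ^ 4 = 4 * theta ^ 2 - 1 := by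
  have h3 : Real.sqrt 3 ^ 2 = 3 := Real.sq_sqrt (by norm_num)
  linear_combination (theta ^ 2 + Real.sqrt 3 - 2) * theta_sq + h3

theorem theta_eq_two_mul_cos : theta = 2 * Real.cos (Real.pi / 12) := by
  have hc : 0 ≤ Real.cos (Real.pi / 12) :=
    Real.cos_nonneg_of_neg_pi_div_two_le_of_le (by linarith [Real.pi_pos])
      (by linarith [Real.pi_pos])
  have ht : 0 ≤ theta := by unfold theta; positivity
  have h := Real.cos_sq (Real.pi / 12)
  rw [show 2 * (Real.pi / 12) = Real.pi / 6 by ring, Real.cos_pi_div_six] at h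
  rw [← abs_of_nonneg ht, ← abs_of_nonneg (show 0 ≤ 2 * Real.cos (Real.pi / 12) by positivity),
    ← sq_eq_sq_iff_abs_eq_abs, theta_sq]
  linear_combination -4 * h

/-- If `t⁴ = 4t² - 1`, then `2` and `(1 + t)⁴` are associated. -/
theorem associated_two_one_add_pow_four {R : Type*} [CommRing R] {t : R}
    (ht : t ^ 4 = 4 * t ^ 2 - 1) : Associated 2 ((1 + t) ^ 4) := by
  have h₁ : IsUnit t := IsUnit.of_mul_eq_one (4 * t - t ^ 3) (by linear_combination -ht)
  have h₂ : IsUnit (2 + t) :=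
    IsUnit.of_mul_eq_one (2 * t ^ 2 - t ^ 3) (by linear_combination -ht)
  have h₃ : IsUnit (1 + 2 * t) :=
    IsUnit.of_mul_eq_one (-15 + 30 * t + 4 * t ^ 2 - 8 * t ^ 3) (by linear_combination -16 * ht)
  obtain ⟨u, hu⟩ := (h₁.mul h₂).mul h₃
  exact ⟨u, by rw [hu]; linear_combination -ht⟩

/-- The polynomial `X⁴ - 4X² + 1`. -/
noncomputable def thetaPoly : ℤ[X] := X ^ 4 - 4 * X ^ 2 + 1

theorem natDegree_thetaPoly : thetaPoly.natDegree = 4 := by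
  unfold thetaPoly; compute_degree!

theorem monic_thetaPoly : thetaPoly.Monic := by
  unfold thetaPoly; monicity!

theorem irreducible_thetaPoly : Irreducible thetaPoly := by
  refine generalizedEisenstein (K := ZMod 2) (q := X - C 1) (p := 4) ?_ (monic_X_sub_C 1)
    monic_thetaPoly.isPrimitive (by simp [natDegree_thetaPoly])
    (by simp [monic_thetaPoly.leadingCoeff]) ?_ ?_
  · rw [Polynomial.map_sub, map_X, map_C]
    exact irreducible_X_sub_C _
  · have h2 : (2 : (ZMod 2)[X]) = 0 := CharTwo.two_eq_zero
    rw [monic_thetaPoly.leadingCoeff]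
    simp only [thetaPoly, Polynomial.map_add, Polynomial.map_sub,
      Polynomial.map_mul, Polynomial.map_pow, map_X, Polynomial.map_ofNat, Polynomial.map_one,
      map_one]
    linear_combination (2 * X ^ 3 - 5 * X ^ 2 + 2 * X) * h2
  · rw [modByMonic_X_sub_C_eq_C_eval, map_C, Ne, C_eq_zero, Ideal.Quotient.eq_zero_iff_mem]
    have hker : RingHom.ker (algebraMap ℤ (ZMod 2)) = Ideal.span {2} := by
      simpa using ZMod.ker_intCastRingHom 2
    rw [hker, Ideal.span_singleton_pow, Ideal.mem_span_singleton]
    simp [thetaPoly]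

theorem aeval_thetaPoly : aeval theta thetaPoly = 0 := by
  have h4 : aeval theta (4 : ℤ[X]) = 4 := map_ofNat _ 4
  simp [thetaPoly, theta_pow_four, h4]

theorem isIntegral_theta : IsIntegral ℤ theta :=
  ⟨thetaPoly, monic_thetaPoly, aeval_thetaPoly⟩

theorem minpoly_rat_theta : minpoly ℚ theta = thetaPoly.map (algebraMap ℤ ℚ) := by
  refine (minpoly.eq_of_irreducible_of_monic
    ((monic_thetaPoly.irreducible_iff_irreducible_map_fraction_map).1 irreducible_thetaPoly) ?_
    (monic_thetaPoly.map _)).symm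
  rw [aeval_map_algebraMap, aeval_thetaPoly]

/-- The root of unity `ζ = exp (2πi/24)` satisfies `ζ² = θζ - 1`. -/
theorem exp_sq_eq : Complex.exp (2 * Real.pi * Complex.I / (24 : ℕ)) ^ 2 =
    theta * Complex.exp (2 * Real.pi * Complex.I / (24 : ℕ)) - 1 := by
  have h : (2 * Real.pi * Complex.I / (24 : ℕ) : ℂ) = (Real.pi / 12 : ℝ) * Complex.I := by
    push_cast; ring
  rw [h, theta_eq_two_mul_cos, Complex.exp_mul_I]
  push_cast
  linear_combination -Complex.sin_sq_add_cos_sq (Real.pi / 12 : ℂ) +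
    Complex.sin (Real.pi / 12 : ℂ) ^ 2 * Complex.I_sq

theorem exp_im_ne_zero : (Complex.exp (2 * Real.pi * Complex.I / (24 : ℕ))).im ≠ 0 := by
  have h : (2 * Real.pi * Complex.I / (24 : ℕ) : ℂ) = (Real.pi / 12 : ℝ) * Complex.I := by
    push_cast; ring
  rw [h, Complex.exp_ofReal_mul_I_im]
  exact (Real.sin_pos_of_pos_of_lt_pi (by positivity) (by linarith [Real.pi_pos])).ne'

theorem theta_mem_B : theta ∈ B := Algebra.subset_adjoin rfl

/-- If `ζ² = θζ - 1` then every element of `ℤ[ζ]` is of the form `a + bζ` with `a, b ∈ ℤ[θ]`. -/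
theorem exists_add_mul_of_mem_adjoin {ζ : ℂ} (hζ : ζ ^ 2 = theta * ζ - 1) {x : ℂ}
    (hx : x ∈ Algebra.adjoin ℤ {ζ}) : ∃ a ∈ B, ∃ b ∈ B, x = a + b * ζ := by
  induction hx using Algebra.adjoin_induction with
  | mem x hx =>
    rw [Set.mem_singleton_iff] at hx
    exact ⟨0, zero_mem _, 1, one_mem _, by simp [hx]⟩
  | algebraMap n => exact ⟨n, intCast_mem _ n, 0, zero_mem _, by simp⟩
  | add x y _ _ hx hy =>
    obtain ⟨a, ha, b, hb, rfl⟩ := hx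
    obtain ⟨c, hc, d, hd, rfl⟩ := hy
    exact ⟨a + c, add_mem ha hc, b + d, add_mem hb hd, by push_cast; ring⟩
  | mul x y _ _ hx hy =>
    obtain ⟨a, ha, b, hb, rfl⟩ := hx
    obtain ⟨c, hc, d, hd, rfl⟩ := hy
    refine ⟨a * c - b * d, sub_mem (mul_mem ha hc) (mul_mem hb hd),
      a * d + b * c + b * d * theta,
      add_mem (add_mem (mul_mem ha hd) (mul_mem hb hc)) (mul_mem (mul_mem hb hd) theta_mem_B), ?_⟩
    push_cast
    linear_combination (b * d : ℂ) * hζ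

theorem mem_B_of_isIntegral {x : ℝ} (hx : x ∈ ℚ⟮theta⟯) (hint : IsIntegral ℤ x) : x ∈ B := by
  set ζ : ℂ := Complex.exp (2 * Real.pi * Complex.I / (24 : ℕ))
  have hζ : IsPrimitiveRoot ζ 24 := Complex.isPrimitiveRoot_exp 24 (by norm_num)
  have hsq : ζ ^ 2 = theta * ζ - 1 := exp_sq_eq
  have hζ_alg : IsAlgebraic ℚ ζ :=
    ((hζ.isIntegral (by norm_num)).tower_top (A := ℚ)).isAlgebraic
  have : IsCyclotomicExtension {24} ℚ ℚ⟮ζ⟯ := by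
    change IsCyclotomicExtension {24} ℚ (ℚ⟮ζ⟯).toSubalgebra
    rw [adjoin_simple_toSubalgebra_of_isAlgebraic hζ_alg]
    exact hζ.adjoin_isCyclotomicExtension ℚ
  have hgen : IsPrimitiveRoot (AdjoinSimple.gen ℚ ζ) 24 :=
    IsPrimitiveRoot.coe_submonoidClass_iff.mp hζ
  have hζ_mem : ζ ∈ ℚ⟮ζ⟯ := mem_adjoin_simple_self ℚ ζ
  have hθ_mem : (theta : ℂ) ∈ ℚ⟮ζ⟯ := by
    have h : (theta : ℂ) = ζ + ζ⁻¹ := by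
      have h0 : ζ ≠ 0 := Complex.exp_ne_zero _
      field_simp
      linear_combination -hsq
    rw [h]
    exact add_mem hζ_mem (inv_mem hζ_mem)
  have hle : ℚ⟮theta⟯ ≤ (ℚ⟮ζ⟯).comap (Complex.ofRealAm.restrictScalars ℚ) := by
    rw [adjoin_simple_le_iff]
    exact hθ_mem
  have hxζ : (x : ℂ) ∈ ℚ⟮ζ⟯ := hle hx
  have hxint : IsIntegral ℤ (⟨x, hxζ⟩ : ℚ⟮ζ⟯) := by
    rw [← isIntegral_algHom_iff ((ℚ⟮ζ⟯).val.restrictScalars ℤ) Subtype.val_injective]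
    exact hint.map (Complex.ofRealAm.restrictScalars ℤ)
  obtain ⟨⟨y, hy⟩, hyx⟩ :=
    (IsCyclotomicExtension.Rat.isIntegralClosure_adjoin_singleton hgen).isIntegral_iff.1 hxint
  have hmem : (x : ℂ) ∈ Algebra.adjoin ℤ {ζ} := by
    have h := (Subalgebra.mem_map (f := (ℚ⟮ζ⟯).val.restrictScalars ℤ)).2 ⟨y, hy, rfl⟩
    rw [AlgHom.map_adjoin_singleton] at h
    have hyx' : y = ⟨x, hxζ⟩ := hyx
    rw [hyx'] at h
    exact h
  obtain ⟨a, ha, b, hb, hab⟩ := exists_add_mul_of_mem_adjoin hsq hmem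
  have hb0 : b = 0 := by
    have him := congrArg Complex.im hab
    have h0 : ζ.im ≠ 0 := exp_im_ne_zero
    simpa [h0] using him
  rw [hb0] at hab
  have : x = a := by exact_mod_cast (show (x : ℂ) = a by simpa using hab)
  exact this ▸ ha

instance : NumberField ℚ⟮theta⟯ where
  to_charZero := inferInstance
  to_finiteDimensional := adjoin.finiteDimensional isIntegral_theta.tower_top

/-- `θ` as an element of the ring of integers of `ℚ(θ)`. -/
noncomputable def thetaInt : 𝓞 ℚ⟮theta⟯ :=
  ⟨AdjoinSimple.gen ℚ theta,
    (isIntegral_algHom_iff ((ℚ⟮theta⟯).val.restrictScalars ℤ) Subtype.val_injective).1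
      isIntegral_theta⟩

/-- The inclusion of the ring of integers of `ℚ(θ)` into `ℝ`. -/
noncomputable def ringOfIntegersToReal : 𝓞 ℚ⟮theta⟯ →ₐ[ℤ] ℝ :=
  ((ℚ⟮theta⟯).val.restrictScalars ℤ).comp (IsScalarTower.toAlgHom ℤ (𝓞 ℚ⟮theta⟯) ℚ⟮theta⟯)

theorem ringOfIntegersToReal_injective : Function.Injective ringOfIntegersToReal :=
  Subtype.val_injective.comp RingOfIntegers.coe_injective

theorem ringOfIntegersToReal_thetaInt : ringOfIntegersToReal thetaInt = theta := rfl

theorem ringOfIntegersToReal_mem_B (x : 𝓞 ℚ⟮theta⟯) : ringOfIntegersToReal x ∈ B :=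
  mem_B_of_isIntegral (x : ℚ⟮theta⟯).2 ((RingOfIntegers.isIntegral x).map ringOfIntegersToReal)

theorem thetaInt_pow_four : thetaInt ^ 4 = 4 * thetaInt ^ 2 - 1 := by
  apply ringOfIntegersToReal_injective
  have h4 : ringOfIntegersToReal 4 = 4 := map_ofNat _ 4
  simp [h4, ringOfIntegersToReal_thetaInt, theta_pow_four]

theorem B_eq_map : B = (Algebra.adjoin ℤ {thetaInt}).map ringOfIntegersToReal := by
  rw [AlgHom.map_adjoin_singleton]
  rfl

theorem adjoin_thetaInt : Algebra.adjoin ℤ {thetaInt} = ⊤ := by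
  refine top_unique fun x _ ↦ ?_
  have h := ringOfIntegersToReal_mem_B x
  rw [B_eq_map] at h
  obtain ⟨y, hy, hyx⟩ := h
  exact ringOfIntegersToReal_injective hyx ▸ hy

/-- The ring homomorphism from the ring of integers of `ℚ(θ)` to `ℤ[θ]`. -/
noncomputable def ringOfIntegersToB : 𝓞 ℚ⟮theta⟯ →ₐ[ℤ] B :=
  ringOfIntegersToReal.codRestrict B ringOfIntegersToReal_mem_B

theorem ringOfIntegersToB_surjective : Function.Surjective ringOfIntegersToB := by
  rintro ⟨x, hx⟩
  rw [B_eq_map] at hx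
  obtain ⟨y, -, hy⟩ := hx
  exact ⟨y, Subtype.ext hy⟩

theorem finrank_adjoin_theta : Module.finrank ℚ ℚ⟮theta⟯ = 4 := by
  rw [adjoin.finrank isIntegral_theta.tower_top, minpoly_rat_theta,
    monic_thetaPoly.natDegree_map, natDegree_thetaPoly]

/-- The power basis of the ring of integers of `ℚ(θ)` given by the powers of `θ`. -/
noncomputable def integralThetaPowerBasis : PowerBasis ℤ (𝓞 ℚ⟮theta⟯) :=
  PowerBasis.ofAdjoinEqTop' (RingOfIntegers.isIntegral thetaInt) adjoin_thetaInt

theorem integralThetaPowerBasis_gen : integralThetaPowerBasis.gen = thetaInt :=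
  PowerBasis.ofAdjoinEqTop'_gen _ _

/-- The power basis of `ℚ(θ)` over `ℚ` obtained from `integralThetaPowerBasis`. -/
noncomputable def thetaPowerBasis : PowerBasis ℚ ℚ⟮theta⟯ where
  gen := AdjoinSimple.gen ℚ theta
  dim := integralThetaPowerBasis.dim
  basis := integralThetaPowerBasis.basis.localizationLocalization ℚ (nonZeroDivisors ℤ) ℚ⟮theta⟯
  basis_eq_pow i := by
    rw [Module.Basis.localizationLocalization_apply, PowerBasis.basis_eq_pow, map_pow,
      integralThetaPowerBasis_gen]
    rfl

theorem discr_eq_discr_thetaPowerBasis :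
    (discr ℚ⟮theta⟯ : ℚ) = Algebra.discr ℚ thetaPowerBasis.basis := by
  rw [← discr_eq_discr _ integralThetaPowerBasis.basis]
  exact (Algebra.discr_localizationLocalization ℤ (nonZeroDivisors ℤ) ℚ⟮theta⟯
    integralThetaPowerBasis.basis).symm

theorem abs_discr_adjoin_theta : |discr ℚ⟮theta⟯| = 2304 := by
  have hpoly : minpoly ℚ thetaPowerBasis.gen = thetaPoly.map (algebraMap ℤ ℚ) := by
    rw [← minpoly_rat_theta]
    exact minpoly_gen ℚ theta
  have hN : |Algebra.norm ℚ thetaPowerBasis.gen| = 1 := by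
    rw [Algebra.PowerBasis.norm_gen_eq_coeff_zero_minpoly, hpoly]
    simp [thetaPoly]
  have hgen : thetaPowerBasis.gen ^ 4 = 4 * thetaPowerBasis.gen ^ 2 - 1 :=
    congrArg (algebraMap (𝓞 ℚ⟮theta⟯) ℚ⟮theta⟯) thetaInt_pow_four
  have hder : aeval thetaPowerBasis.gen (minpoly ℚ thetaPowerBasis.gen).derivative ^ 2 =
      algebraMap ℚ _ 48 * thetaPowerBasis.gen ^ 2 := by
    have h : aeval thetaPowerBasis.gen (minpoly ℚ thetaPowerBasis.gen).derivative =
        4 * thetaPowerBasis.gen ^ 3 - 8 * thetaPowerBasis.gen := by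
      have h4 : aeval thetaPowerBasis.gen (4 : ℚ[X]) = 4 := map_ofNat _ 4
      rw [hpoly]
      simp [thetaPoly, h4]
      ring
    rw [h, map_ofNat]
    linear_combination 16 * thetaPowerBasis.gen ^ 2 * hgen
  have hD : Algebra.norm ℚ (aeval thetaPowerBasis.gen
      (minpoly ℚ thetaPowerBasis.gen).derivative) ^ 2 = 2304 ^ 2 := by
    rw [← map_pow, hder, map_mul, Algebra.norm_algebraMap, finrank_adjoin_theta,
      map_pow, ← sq_abs (Algebra.norm ℚ thetaPowerBasis.gen), hN]
    norm_num
  rw [← sq_abs] at hD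
  have h := (sq_eq_sq₀ (abs_nonneg _) (by norm_num)).1 hD
  have : |(discr ℚ⟮theta⟯ : ℚ)| = 2304 := by
    rw [discr_eq_discr_thetaPowerBasis, Algebra.discr_powerBasis_eq_norm ℚ thetaPowerBasis,
      abs_mul, h]
    simp
  exact_mod_cast this

theorem exists_int_one_add_thetaInt_dvd_sub (x : 𝓞 ℚ⟮theta⟯) :
    ∃ n : ℤ, 1 + thetaInt ∣ x - n := by
  have hx : x ∈ Algebra.adjoin ℤ {thetaInt} := adjoin_thetaInt ▸ Algebra.mem_top
  induction hx using Algebra.adjoin_induction with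
  | mem x hx =>
    rw [Set.mem_singleton_iff] at hx
    exact ⟨-1, 1, by rw [hx]; push_cast; ring⟩
  | algebraMap n => exact ⟨n, by simp⟩
  | add x y _ _ hx hy =>
    obtain ⟨m, c, hc⟩ := hx
    obtain ⟨n, d, hd⟩ := hy
    exact ⟨m + n, c + d, by push_cast; linear_combination hc + hd⟩
  | mul x y _ _ hx hy =>
    obtain ⟨m, c, hc⟩ := hx
    obtain ⟨n, d, hd⟩ := hy
    exact ⟨m * n, c * y + d * m, by push_cast; linear_combination y * hc + m * hd⟩

theorem eq_span_of_two_mem {P : Ideal (𝓞 ℚ⟮theta⟯)} (hP : P.IsPrime) (h2 : 2 ∈ P) :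
    P = Ideal.span {1 + thetaInt} := by
  have hassoc := associated_two_one_add_pow_four thetaInt_pow_four
  have hmem : 1 + thetaInt ∈ P :=
    hP.mem_of_pow_mem 4 (P.mem_of_dvd hassoc.dvd h2)
  refine le_antisymm (fun x hx ↦ ?_) ((Ideal.span_singleton_le_iff_mem _).2 hmem)
  obtain ⟨n, hn⟩ := exists_int_one_add_thetaInt_dvd_sub x
  have hnP : (n : 𝓞 ℚ⟮theta⟯) ∈ P := by
    simpa using P.sub_mem hx (P.mem_of_dvd hn hmem)
  have hdvd2 : 1 + thetaInt ∣ 2 := (dvd_pow_self _ four_ne_zero).trans hassoc.symm.dvd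
  obtain ⟨k, rfl | rfl⟩ := n.even_or_odd'
  · rw [Ideal.mem_span_singleton, ← dvd_sub_left (hdvd2.mul_right k)]
    simpa using hn
  · refine absurd ?_ hP.one_notMem
    simpa using P.sub_mem hnP (P.mul_mem_right (k : 𝓞 ℚ⟮theta⟯) h2)

/-- A nonzero prime ideal of norm less than `8` contains `2`, since `X⁴ - 4X² + 1` has no root
modulo `3`, `5` or `7`. -/
theorem two_mem_of_absNorm_lt_eight {P : Ideal (𝓞 ℚ⟮theta⟯)} (hP : P.IsPrime)
    (hP0 : P ≠ ⊥) (h : Ideal.absNorm P < 8) : 2 ∈ P := by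
  have hmem : (Ideal.absNorm P : 𝓞 ℚ⟮theta⟯) ∈ P := Ideal.absNorm_mem P
  have hmax : P.IsMaximal := hP.isMaximal hP0
  have hne0 : Ideal.absNorm P ≠ 0 := Ideal.absNorm_eq_zero_iff.not.2 hP0
  have hne1 : Ideal.absNorm P ≠ 1 := Ideal.absNorm_eq_one_iff.not.2 hP.ne_top
  let _ : Field (𝓞 ℚ⟮theta⟯ ⧸ P) := Ideal.Quotient.field P
  have hcard : Nat.card (𝓞 ℚ⟮theta⟯ ⧸ P) = Ideal.absNorm P := rfl
  have : Finite (𝓞 ℚ⟮theta⟯ ⧸ P) := Nat.finite_of_card_ne_zero (hcard ▸ hne0)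
  let _ : Fintype (𝓞 ℚ⟮theta⟯ ⧸ P) := Fintype.ofFinite _
  rw [Nat.card_eq_fintype_card] at hcard
  have hroot (p : ℕ) (hp : p.Prime) (hpP : Ideal.absNorm P = p) :
      ∃ t : ZMod p, t ^ 4 = 4 * t ^ 2 - 1 := by
    have : Fact p.Prime := ⟨hp⟩
    let e := ZMod.ringEquivOfPrime (𝓞 ℚ⟮theta⟯ ⧸ P) hp (hcard.trans hpP)
    refine ⟨e.symm (Ideal.Quotient.mk P thetaInt), ?_⟩
    have h4 : e.symm (Ideal.Quotient.mk P 4) = 4 := by rw [map_ofNat, map_ofNat]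
    simpa [h4] using congrArg (fun x ↦ e.symm (Ideal.Quotient.mk P x)) thetaInt_pow_four
  have hpow (h4 : Ideal.absNorm P = 4) : 2 ∈ P := by
    rw [h4] at hmem
    exact hP.mem_of_pow_mem 2 (by convert hmem; norm_num)
  interval_cases hc : Ideal.absNorm P
  · exact absurd rfl hne0
  · exact absurd rfl hne1
  · exact_mod_cast hmem
  · exact absurd (hroot 3 (by norm_num) rfl) (by decide)
  · exact hpow rfl
  · exact absurd (hroot 5 (by norm_num) rfl) (by decide)
  · have h6 := FiniteField.isPrimePow_card (𝓞 ℚ⟮theta⟯ ⧸ P)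
    rw [hcard, isPrimePow_nat_iff_bounded] at h6
    exact absurd h6 (by decide)
  · exact absurd (hroot 7 (by norm_num) rfl) (by decide)

theorem isPrincipalIdealRing_ringOfIntegers : IsPrincipalIdealRing (𝓞 ℚ⟮theta⟯) := by
  refine RingOfIntegers.isPrincipalIdealRing_of_isPrincipal_of_norm_le_of_isPrime
    fun I hI hle ↦ ?_
  rw [finrank_adjoin_theta, ← Int.cast_abs, abs_discr_adjoin_theta] at hle
  have hr : InfinitePlace.nrComplexPlaces ℚ⟮theta⟯ ≤ 2 := by
    have := InfinitePlace.card_add_two_mul_card_eq_rank ℚ⟮theta⟯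
    rw [finrank_adjoin_theta] at this
    omega
  have hsqrt : Real.sqrt (2304 : ℤ) = 48 := by
    rw [show ((2304 : ℤ) : ℝ) = 48 ^ 2 by norm_num]
    exact Real.sqrt_sq (by norm_num)
  have hpi : (4 / Real.pi) ^ InfinitePlace.nrComplexPlaces ℚ⟮theta⟯ ≤ (4 / 3.1) ^ 2 := by
    have h1 : 1 ≤ 4 / Real.pi := (one_le_div Real.pi_pos).2 Real.pi_le_four
    calc (4 / Real.pi) ^ InfinitePlace.nrComplexPlaces ℚ⟮theta⟯
        ≤ (4 / Real.pi) ^ 2 := pow_le_pow_right₀ h1 hr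
      _ ≤ (4 / 3.1) ^ 2 := by
        gcongr
        linarith [Real.pi_gt_d2]
  have hlt : (Ideal.absNorm (I : Ideal (𝓞 ℚ⟮theta⟯)) : ℝ) < 8 := by
    rw [hsqrt] at hle
    norm_num [Nat.factorial] at hle hpi
    linarith
  have h2 := two_mem_of_absNorm_lt_eight hI (nonZeroDivisors.coe_ne_zero I) (by exact_mod_cast hlt)
  exact ⟨_, eq_span_of_two_mem hI h2⟩

theorem B_pid_and_two_eq_one_add_theta_pow_four :
    IsPrincipalIdealRing B ∧ IsDomain B ∧
      Ideal.span {(2 : B)} = Ideal.span {(1 + θB) ^ 4} := by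
  have := isPrincipalIdealRing_ringOfIntegers
  have hθ : θB ^ 4 = 4 * θB ^ 2 - 1 := Subtype.ext theta_pow_four
  exact ⟨IsPrincipalIdealRing.of_surjective ringOfIntegersToB ringOfIntegersToB_surjective,
    inferInstance, Ideal.span_singleton_eq_span_singleton.2 (associated_two_one_add_pow_four hθ)⟩
end
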